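/- Let ℓ ≥ 3 and h ≥ 1, and let I_{ℓ,ℓ+h} ⊆ MvPolynomial (Fin ℓ × Fin (ℓ+h)) ℂ be the ideal generated by the permanents of all ℓ×ℓ submatrices of the generic ℓ×(ℓ+h) matrix over ℂ. Then Ideal.height I_{ℓ,ℓ+h} ≥ h+3; equivalently, the codimension of P_{ℓ,ℓ+h} in ℂ^{ℓ×(ℓ+h)} is at least h+3. -/

import Mathlib

open MvPolynomial

noncomputable section

/-- The permanent of a square matrix. -/
def perm {R : Type*} [CommRing R] {m : ℕ} (A : Matrix (Fin m) (Fin m) R) : R :=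
  ∑ σ : Equiv.Perm (Fin m), ∏ i, A i (σ i)

/-- The height of an ideal: the infimum of the heights (in the prime spectrum)
of the primes containing it. -/
def idealHeight {R : Type*} [CommRing R] (I : Ideal R) : ℕ∞ :=
  ⨅ (p : PrimeSpectrum R) (_ : I ≤ p.asIdeal), Order.height p

/-- The maximal permanental ideal `I_{ℓ,ℓ+h}`: the ideal generated by the permanents of
all `ℓ × ℓ` submatrices of the generic `ℓ × (ℓ+h)` matrix over `ℂ`, obtained by selecting
`ℓ` of the `ℓ + h` columns via a strictly monotone map. -/
def permanentalIdeal (l h : ℕ) : Ideal (MvPolynomial (Fin l × Fin (l + h)) ℂ) :=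
  Ideal.span { p | ∃ c : Fin l → Fin (l + h), StrictMono c ∧
    p = perm (Matrix.of fun i j => X (i, c j)) }

/-- The relative algebraic closure of `F(s)` in `K`. -/
def relAlgClosure (F : Type*) {K : Type*} [Field F] [Field K] [Algebra F K] (s : Set K) :
    IntermediateField F K :=
  (algebraicClosure (IntermediateField.adjoin F s) K).restrictScalars F

/-- The family `x` is algebraic over a subfamily that omits at least `c` indices; equivalently,
the transcendence degree of `F(x)` over `F` is at most the number of indices minus `c`. -/
def AlgDefect (F : Type*) {K ι : Type*} [Field F] [Field K] [Algebra F K] [Fintype ι]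
    (x : ι → K) (c : ℕ) : Prop :=
  ∃ B : Finset ι, B.card + c ≤ Fintype.card ι ∧ ∀ i, x i ∈ relAlgClosure F (x '' B)

section AlgDefect

variable {F K : Type*} [Field F] [Field K] [Algebra F K]

lemma mem_relAlgClosure_iff_isAlgebraic_field {s : Set K} {a : K} :
    a ∈ relAlgClosure F s ↔ IsAlgebraic (IntermediateField.adjoin F s) a := by
  rw [relAlgClosure, IntermediateField.mem_restrictScalars, mem_algebraicClosure_iff]

lemma mem_relAlgClosure {s : Set K} {a : K} :
    a ∈ relAlgClosure F s ↔ IsAlgebraic (Algebra.adjoin F s) a := by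
  open IntermediateField.algebraAdjoinAdjoin in
  have := IsFractionRing.isAlgebraic_iff (Algebra.adjoin F s) (IntermediateField.adjoin F s) K
    (x := a)
  rw [this, mem_relAlgClosure_iff_isAlgebraic_field]

lemma subset_relAlgClosure (s : Set K) : s ⊆ relAlgClosure F s := fun a ha ↦
  mem_relAlgClosure.2
    (isAlgebraic_algebraMap (⟨a, Algebra.subset_adjoin ha⟩ : Algebra.adjoin F s))

lemma relAlgClosure_le {s t : Set K} (h : s ⊆ relAlgClosure F t) :
    relAlgClosure F s ≤ relAlgClosure F t := by
  intro a ha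
  let E := IntermediateField.adjoin F t
  have h1 : IntermediateField.adjoin F s ≤ relAlgClosure F t :=
    IntermediateField.adjoin_le_iff.2 h
  have ha' : IsAlgebraic (IntermediateField.adjoin F s) a :=
    mem_relAlgClosure_iff_isAlgebraic_field.1 ha
  have h2 : IsAlgebraic (algebraicClosure E K) a := by
    let f : IntermediateField.adjoin F s →+* algebraicClosure E K :=
      (IntermediateField.inclusion h1).toRingHom
    obtain ⟨p, hp, hpa⟩ := ha'
    refine ⟨p.map f, (Polynomial.map_ne_zero_iff f.injective).2 hp, ?_⟩
    rw [Polynomial.aeval_def, Polynomial.eval₂_map]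
    exact hpa
  exact mem_relAlgClosure_iff_isAlgebraic_field.2 (h2.restrictScalars E)

lemma relAlgClosure_mono {s t : Set K} (h : s ⊆ t) : relAlgClosure F s ≤ relAlgClosure F t :=
  relAlgClosure_le (h.trans (subset_relAlgClosure t))

variable {ι ι' : Type*} [Fintype ι] [Fintype ι']

/-- Each index outside the image of `f` whose value lies in every field containing the values
outside `E` adds one to the defect. -/
lemma AlgDefect.extend {x : ι → K} {c : ℕ} {f : ι' → ι} (hf : Function.Injective f)
    (hc : AlgDefect F (x ∘ f) c) {E : Finset ι} (hE : ∀ i, f i ∉ E)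
    (h : ∀ L : IntermediateField F K, (∀ i ∉ E, x i ∈ L) → ∀ i ∈ E, x i ∈ L) :
    AlgDefect F x (c + E.card) := by
  classical
  obtain ⟨B, hB, hx⟩ := hc
  let D : Finset ι := Finset.univ \ (Finset.univ.image f ∪ E)
  refine ⟨B.image f ∪ D, ?_, ?_⟩
  · have h1 : (Finset.univ.image f ∪ E).card = Fintype.card ι' + E.card := by
      rw [Finset.card_union_of_disjoint, Finset.card_image_of_injective _ hf, Finset.card_univ]
      rw [Finset.disjoint_left]
      simpa using hE
    have h2 : D.card + (Finset.univ.image f ∪ E).card = Fintype.card ι :=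
      Finset.card_sdiff_add_card_eq_card (Finset.subset_univ _)
    have h3 := Finset.card_union_le (B.image f) D
    have h4 : (B.image f).card ≤ B.card := Finset.card_image_le
    lia
  · have key : ∀ i ∉ E, x i ∈ relAlgClosure F (x '' (B.image f ∪ D : Finset ι)) := by
      intro i hi
      by_cases hi' : ∃ j, f j = i
      · obtain ⟨j, rfl⟩ := hi'
        refine relAlgClosure_mono ?_ (hx j)
        rintro _ ⟨b, hb, rfl⟩
        exact ⟨f b, by simpa using Or.inl ⟨b, hb, rfl⟩, rfl⟩
      · push Not at hi'
        exact subset_relAlgClosure _ ⟨i, by simp [D, hi, hi'], rfl⟩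
    intro i
    by_cases hi : i ∈ E
    · exact h _ key i hi
    · exact key i hi

lemma AlgDefect.mono {x : ι → K} {c d : ℕ} (hc : AlgDefect F x c) (h : d ≤ c) :
    AlgDefect F x d := by
  obtain ⟨B, hB, hx⟩ := hc
  exact ⟨B, by lia, hx⟩

lemma AlgDefect.comp {x : ι → K} {c : ℕ} {f : ι' → ι} (hf : Function.Injective f)
    (hc : AlgDefect F (x ∘ f) c) : AlgDefect F x c :=
  AlgDefect.extend hf hc (E := ∅) (by simp) (by simp)

/-- Each index whose value lies in every field containing the other values adds one to the
defect. -/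
lemma AlgDefect.of_finset {x : ι → K} {E : Finset ι}
    (h : ∀ L : IntermediateField F K, (∀ i ∉ E, x i ∈ L) → ∀ i ∈ E, x i ∈ L) :
    AlgDefect F x E.card := by
  have h0 : AlgDefect F (x ∘ (Empty.elim : Empty → ι)) 0 := ⟨∅, by simp, by simp⟩
  simpa using h0.extend (fun i ↦ i.elim) (fun i ↦ i.elim) h

lemma AlgDefect.of_not_algebraicIndependent {x : ι → K} (hx : ¬ AlgebraicIndependent F x) :
    AlgDefect F x 1 := by
  classical
  by_contra hd
  refine hx (algebraicIndependent_of_finite_type' (algebraMap F K).injective fun t _ _ i hi ha ↦ ?_)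
  refine hd ⟨Finset.univ.erase i, ?_, fun j ↦ ?_⟩
  · have := Fintype.card_pos_iff.2 ⟨i⟩
    rw [Finset.card_erase_of_mem (Finset.mem_univ i), Finset.card_univ]
    lia
  · by_cases hj : j = i
    · subst hj
      refine relAlgClosure_mono (Set.image_mono ?_) (mem_relAlgClosure.2 ha)
      intro b hb
      simpa using fun h : b = j ↦ hi (h ▸ hb)
    · exact subset_relAlgClosure _ ⟨j, by simpa using hj, rfl⟩

end AlgDefect

section Height

/-- If each variable satisfies a polynomial over `A` that is nontrivial modulo `q`, then the prime
`q` has height at least the number of variables. -/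
lemma le_height_of_algebraic {A : Type*} [CommRing A] (n : ℕ)
    (q : PrimeSpectrum (MvPolynomial (Fin n) A))
    (hq : ∀ i, ∃ g : Polynomial A, (∃ k, C (g.coeff k) ∉ q.asIdeal) ∧
      Polynomial.aeval (X i : MvPolynomial (Fin n) A) g ∈ q.asIdeal) :
    (n : ℕ∞) ≤ Order.height q := by
  induction n with
  | zero => simp
  | succ n ih =>
    let e := (finSuccEquiv A n).toRingEquiv
    have he : Order.height (PrimeSpectrum.comapEquiv e q) = Order.height q :=
      Order.height_orderIso _ _
    set Q := PrimeSpectrum.comapEquiv e q with hQ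
    have memQ : ∀ y, e y ∈ Q.asIdeal ↔ y ∈ q.asIdeal := by
      intro y
      change e.symm (e y) ∈ q.asIdeal ↔ _
      rw [e.symm_apply_apply]
    let φ : PrimeSpectrum (MvPolynomial (Fin n) A) →
        PrimeSpectrum (Polynomial (MvPolynomial (Fin n) A)) :=
      fun p ↦ ⟨p.asIdeal.map Polynomial.C, Ideal.isPrime_map_C_of_isPrime⟩
    have hφ : StrictMono φ := by
      refine Monotone.strictMono_of_injective (fun p p' h ↦ Ideal.map_mono h) fun p p' h ↦ ?_
      have h' : p.asIdeal.map Polynomial.C = p'.asIdeal.map Polynomial.C := congrArg (·.asIdeal) h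
      ext y
      have h1 := Ideal.mem_map_C_iff (I := p.asIdeal) (f := Polynomial.C y)
      have h2 := Ideal.mem_map_C_iff (I := p'.asIdeal) (f := Polynomial.C y)
      rw [h', h2] at h1
      have aux : ∀ J : Ideal (MvPolynomial (Fin n) A),
          (∀ k, (Polynomial.C y).coeff k ∈ J) ↔ y ∈ J := by
        refine fun J ↦ ⟨fun h ↦ by simpa using h 0, fun h k ↦ ?_⟩
        rw [Polynomial.coeff_C]
        split_ifs
        · exact h
        · exact J.zero_mem
      rw [aux, aux] at h1
      exact h1.symm
    let q' : PrimeSpectrum (MvPolynomial (Fin n) A) := PrimeSpectrum.comap Polynomial.C Q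
    have eC : ∀ a, e (C a) = Polynomial.C (C a) := fun a ↦ by
      simp [e, finSuccEquiv_apply]
    have hq' : (n : ℕ∞) ≤ Order.height q' := by
      refine ih q' fun i ↦ ?_
      obtain ⟨g, ⟨k, hk⟩, hg⟩ := hq i.succ
      refine ⟨g, ⟨k, fun h ↦ hk ?_⟩, ?_⟩
      · rw [← memQ, eC]
        exact h
      · rw [← memQ] at hg
        change Polynomial.C _ ∈ Q.asIdeal
        have h1 := Polynomial.aeval_algHom_apply (finSuccEquiv A n) (X i.succ) g
        have h2 := Polynomial.aeval_algHom_apply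
          (IsScalarTower.toAlgHom A (MvPolynomial (Fin n) A) (Polynomial (MvPolynomial (Fin n) A)))
          (X i) g
        rw [finSuccEquiv_X_succ] at h1
        have h3 : Polynomial.C (Polynomial.aeval (X i : MvPolynomial (Fin n) A) g) =
            finSuccEquiv A n (Polynomial.aeval (X i.succ) g) := h2.symm.trans h1
        rw [h3]
        exact hg
    have hlt : φ q' < Q := by
      refine lt_of_le_of_ne (Ideal.map_le_iff_le_comap.2 le_rfl) fun h ↦ ?_
      obtain ⟨g, ⟨k, hk⟩, hg⟩ := hq 0
      rw [← memQ] at hg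
      have hg' : finSuccEquiv A n (Polynomial.aeval (X 0) g) ∈ Q.asIdeal := hg
      rw [← Polynomial.aeval_algHom_apply, finSuccEquiv_X_zero, ← h] at hg'
      have := Ideal.mem_map_C_iff.1 hg' k
      refine hk ((memQ _).1 ?_)
      rw [eC]
      change Polynomial.C _ ∈ Q.asIdeal at this
      convert this
      have : Polynomial.aeval (Polynomial.X : Polynomial (MvPolynomial (Fin n) A)) g =
          g.map C := by
        rw [Polynomial.aeval_def, Polynomial.map]
        rfl
      rw [this, Polynomial.coeff_map]
    calc ((n + 1 : ℕ) : ℕ∞) = n + 1 := by push_cast; rfl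
      _ ≤ Order.height q' + 1 := by gcongr
      _ ≤ Order.height (φ q') + 1 := by
        gcongr
        exact Order.height_le_height_apply_of_strictMono _ hφ _
      _ ≤ Order.height Q := Order.height_add_one_le hlt
      _ = Order.height q := he

/-- The height of a prime is at least the algebraic defect of the images of the variables in a
field containing the quotient. -/
lemma AlgDefect.le_height {F ι : Type*} [Field F] [Fintype ι]
    (p : PrimeSpectrum (MvPolynomial ι F)) {K : Type*} [Field K] [Algebra F K]
    (φ : MvPolynomial ι F →ₐ[F] K) (hφ : ∀ f, φ f = 0 ↔ f ∈ p.asIdeal) {c : ℕ}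
    (hc : AlgDefect F (fun i ↦ φ (X i)) c) : (c : ℕ∞) ≤ Order.height p := by
  classical
  obtain ⟨B, hB, hx⟩ := hc
  obtain ⟨n, hn⟩ : ∃ n, Fintype.card {i // i ∉ B} = n := ⟨_, rfl⟩
  have hcn : c ≤ n := by
    have := Fintype.card_subtype_compl (fun i ↦ i ∈ B)
    rw [Fintype.card_coe] at this
    lia
  let u : Fin n ≃ {i // i ∉ B} := (Fintype.equivFinOfCardEq hn).symm
  let A := MvPolynomial {i // i ∈ B} F
  let s : Fin n ⊕ {i // i ∈ B} ≃ ι :=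
    ((Equiv.sumComm _ _).trans ((Equiv.refl _).sumCongr u)).trans (Equiv.sumCompl (· ∈ B))
  let e : MvPolynomial (Fin n) A ≃ₐ[F] MvPolynomial ι F :=
    (sumAlgEquiv F (Fin n) {i // i ∈ B}).symm.trans (renameEquiv F s)
  let q := PrimeSpectrum.comapEquiv e.symm.toRingEquiv p
  have he : Order.height q = Order.height p := Order.height_orderIso _ _
  have memq : ∀ y, y ∈ q.asIdeal ↔ φ (e y) = 0 := fun y ↦ (hφ _).symm
  have eC : ∀ a : A, e (C a) = rename Subtype.val a := by
    have : e.toAlgHom.comp (IsScalarTower.toAlgHom F A (MvPolynomial (Fin n) A)) =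
        rename Subtype.val := by
      refine algHom_ext fun i ↦ ?_
      change rename s ((sumAlgEquiv F (Fin n) {i // i ∈ B}).symm (C (X i))) = _
      rw [sumAlgEquiv_symm_C_X, rename_X, rename_X]
      rfl
    exact DFunLike.congr_fun this
  have eX : ∀ i, e (X i) = X (u i : ι) := by
    intro i
    change rename s ((sumAlgEquiv F (Fin n) {i // i ∈ B}).symm (X i)) = _
    rw [sumAlgEquiv_symm_X, rename_X]
    rfl
  rw [← he]
  refine le_trans (by exact_mod_cast hcn) (le_height_of_algebraic n q fun i ↦ ?_)
  let ψ : A →ₐ[F] K := φ.comp (rename Subtype.val)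
  have hψ : ψ.range = Algebra.adjoin F ((fun i ↦ φ (X i)) '' B) := by
    have : ψ = aeval fun i : {i // i ∈ B} ↦ φ (X (i : ι)) := by
      refine algHom_ext fun i ↦ ?_
      simp [ψ]
    rw [this, ← Algebra.adjoin_range_eq_range_aeval]
    congr 1
    ext y
    simp
  have halg := mem_relAlgClosure.1 (hx (u i))
  rw [← hψ] at halg
  obtain ⟨g, hg0, hg⟩ := halg
  obtain ⟨g, rfl⟩ := Polynomial.map_surjective (ψ.rangeRestrict : A →+* ψ.range)
    ψ.rangeRestrict_surjective g
  refine ⟨g, ?_, ?_⟩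
  · obtain ⟨k, hk⟩ := Polynomial.ext_iff.not.1 hg0 |> not_forall.1
    refine ⟨k, fun h ↦ hk ?_⟩
    rw [memq, eC] at h
    rw [Polynomial.coeff_map]
    exact Subtype.ext h
  · rw [memq]
    rw [Polynomial.aeval_def, Polynomial.eval₂_map] at hg
    let θ : MvPolynomial (Fin n) A →+* K := (φ : MvPolynomial ι F →+* K).comp e.toRingEquiv
    have hθC : θ.comp (algebraMap A (MvPolynomial (Fin n) A)) =
        (algebraMap ψ.range K).comp (ψ.rangeRestrict : A →+* ψ.range) :=
      RingHom.ext fun a ↦ congrArg φ (eC a)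
    have hθX : θ (X i) = φ (X (u i : ι)) := congrArg φ (eX i)
    change θ _ = 0
    rw [Polynomial.aeval_def, Polynomial.hom_eval₂, hθC, hθX]
    exact hg

end Height

section Perm

variable {R : Type*} [CommRing R] {m : ℕ}

lemma perm_eq_sum_prod_apply (V : Matrix (Fin m) (Fin m) R) :
    perm V = ∑ σ : Equiv.Perm (Fin m), ∏ i, V (σ i) i := by
  rw [perm, ← Equiv.sum_comp (Equiv.inv (Equiv.Perm (Fin m)))]
  refine Finset.sum_congr rfl fun σ _ ↦ ?_
  rw [← Equiv.prod_comp σ]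
  simp

lemma perm_submatrix_equiv (V : Matrix (Fin m) (Fin m) R) (π : Equiv.Perm (Fin m)) :
    perm (V.submatrix π id) = perm V := by
  rw [perm_eq_sum_prod_apply, perm_eq_sum_prod_apply]
  exact Equiv.sum_comp (Equiv.mulLeft π) fun σ ↦ ∏ i, V (σ i) i

lemma map_perm {S : Type*} [CommRing S] (φ : R →+* S) (V : Matrix (Fin m) (Fin m) R) :
    φ (perm V) = perm (V.map φ) := by
  simp [perm]

/-- The permanent as a multilinear map of the rows. -/
def permMultilinear (R : Type*) [CommRing R] (m : ℕ) :
    MultilinearMap R (fun _ : Fin m ↦ Fin m → R) R :=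
  ∑ σ : Equiv.Perm (Fin m), (MultilinearMap.mkPiAlgebra R (Fin m) R).compLinearMap
    fun a ↦ LinearMap.proj (σ a)

lemma permMultilinear_apply (V : Fin m → Fin m → R) :
    permMultilinear R m V = perm (Matrix.of V) := by
  simp [permMultilinear, perm]

lemma perm_updateRow (V : Matrix (Fin m) (Fin m) R) (a : Fin m) (v : Fin m → R) :
    perm (V.updateRow a v) = ∑ i, v i * perm (V.updateRow a (Pi.single i (1 : R))) := by
  have h (w : Fin m → R) : perm (V.updateRow a w) =
      permMultilinear R m (Function.update (Matrix.of.symm V) a w) :=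
    (permMultilinear_apply _).symm
  simp only [h]
  nth_rewrite 1 [pi_eq_sum_univ' v]
  rw [MultilinearMap.map_update_sum]
  refine Finset.sum_congr rfl fun i _ ↦ ?_
  rw [MultilinearMap.map_update_smul, smul_eq_mul]

/-- Expansion of the permanent along the first column. -/
lemma perm_succ (V : Matrix (Fin (m + 1)) (Fin (m + 1)) R) :
    perm V = ∑ t, V t 0 * perm (Matrix.of fun a i : Fin m ↦ V (Equiv.swap 0 t a.succ) i.succ) := by
  rw [perm_eq_sum_prod_apply, ← Equiv.sum_comp Equiv.Perm.decomposeFin.symm,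
    Fintype.sum_prod_type]
  refine Finset.sum_congr rfl fun t _ ↦ ?_
  rw [perm_eq_sum_prod_apply, Finset.mul_sum]
  refine Finset.sum_congr rfl fun e _ ↦ ?_
  rw [Fin.prod_univ_succ, Equiv.Perm.decomposeFin_symm_apply_zero]
  simp only [Equiv.Perm.decomposeFin_symm_apply_succ, Matrix.of_apply]

lemma perm_one : perm (1 : Matrix (Fin m) (Fin m) R) = 1 := by
  rw [perm, Finset.sum_eq_single 1]
  · exact Finset.prod_eq_one fun i _ ↦ Matrix.one_apply_eq i
  · intro σ _ hσ
    obtain ⟨i, hi⟩ := not_forall.1 fun h ↦ hσ (Equiv.ext h)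
    exact Finset.prod_eq_zero (Finset.mem_univ i) (Matrix.one_apply_ne (Ne.symm hi))
  · simp

lemma perm_updateRow_one_of_ne {a i : Fin m} (h : i ≠ a) :
    perm ((1 : Matrix (Fin m) (Fin m) R).updateRow a (Pi.single i (1 : R))) = 0 := by
  refine Finset.sum_eq_zero fun σ _ ↦ ?_
  by_cases hi : σ i = i
  · refine Finset.prod_eq_zero (Finset.mem_univ a) ?_
    rw [Matrix.updateRow_self, Pi.single_eq_of_ne]
    exact fun h' ↦ h (σ.injective (hi.trans h'.symm))
  · refine Finset.prod_eq_zero (Finset.mem_univ i) ?_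
    rw [Matrix.updateRow_ne h]
    exact Matrix.one_apply_ne (Ne.symm hi)

variable {κ : Type*}

/-- The permanent of the square matrix formed by the columns `τ 0, τ 1, …` of `y`. -/
def permCols (y : Fin m → κ → R) (τ : Fin m → κ) : R :=
  perm (Matrix.of fun a i ↦ y i (τ a))

/-- The permanent of the columns `τ` of `y`, with the column `τ a` replaced by the `i`-th
standard basis vector. -/
def permCofactor (y : Fin m → κ → R) (τ : Fin m → κ) (a i : Fin m) : R :=
  perm ((Matrix.of fun a i ↦ y i (τ a)).updateRow a (Pi.single i (1 : R)))

/-- Adjoin a row to `y` such that all maximal permanents vanish. Its entries in the columns `j`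
and `k` can be eliminated from the permanent on the columns `τ` with `τ a` removed and `j`, `k`
added; this is the resulting coefficient of its entry in the column `τ i`. -/
def permRelCoeff (y : Fin m → κ → R) (τ : Fin m → κ) (j k : κ) (a i : Fin m) : R :=
  (if i = a then 0 else
    permCols y τ * permCols y (Function.update (Function.update τ a k) i j)) -
  permCols y (Function.update τ i j) * permCols y (Function.update τ a k) -
  permCols y (Function.update τ i k) * permCols y (Function.update τ a j)

lemma map_permCols {S : Type*} [CommRing S] (φ : R →+* S) (y : Fin m → κ → R) (τ : Fin m → κ) :
    φ (permCols y τ) = permCols (fun i k ↦ φ (y i k)) τ :=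
  map_perm φ _

lemma map_permCofactor {S : Type*} [CommRing S] (φ : R →+* S) (y : Fin m → κ → R)
    (τ : Fin m → κ) (a i : Fin m) :
    φ (permCofactor y τ a i) = permCofactor (fun i k ↦ φ (y i k)) τ a i := by
  rw [permCofactor, map_perm, permCofactor]
  congr 1
  ext b c
  by_cases h : b = a
  · subst h
    simp [Pi.single_apply, apply_ite φ]
  · simp [Matrix.updateRow_ne h]

lemma map_permRelCoeff {S : Type*} [CommRing S] (φ : R →+* S) (y : Fin m → κ → R)
    (τ : Fin m → κ) (j k : κ) (a i : Fin m) :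
    φ (permRelCoeff y τ j k a i) = permRelCoeff (fun i k ↦ φ (y i k)) τ j k a i := by
  simp only [permRelCoeff, map_sub, map_mul, map_permCols, apply_ite φ, map_zero]

lemma permCols_update (y : Fin m → κ → R) (τ : Fin m → κ) (a : Fin m) (l : κ) :
    permCols y (Function.update τ a l) = ∑ i, y i l * permCofactor y τ a i := by
  rw [permCols]
  refine Eq.trans ?_ (perm_updateRow _ a fun i ↦ y i l)
  congr 1
  ext b c
  by_cases h : b = a
  · subst h
    simp
  · simp [Function.update_of_ne h, Matrix.updateRow_ne h]

lemma permCols_eq_sum (y : Fin m → κ → R) (τ : Fin m → κ) (a : Fin m) :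
    permCols y τ = ∑ i, y i (τ a) * permCofactor y τ a i := by
  rw [← permCols_update, Function.update_eq_self]

/-- Expansion of a permanent along the first row of `x`. -/
lemma permCols_cons (x : Fin (m + 1) → κ → R) (τ : Fin m → κ) (j : κ) :
    permCols x (Fin.cons j τ : Fin (m + 1) → κ) = x 0 j * permCols (fun i ↦ x i.succ) τ +
      ∑ a, x 0 (τ a) * permCols (fun i ↦ x i.succ) (Function.update τ a j) := by
  rw [permCols, perm_succ, Fin.sum_univ_succ]
  congr 1
  refine Finset.sum_congr rfl fun a _ ↦ ?_
  rw [permCols]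
  simp only [Matrix.of_apply, Fin.cons_succ]
  congr 2
  ext b i
  simp only [Matrix.of_apply]
  congr 1
  by_cases h : b = a
  · subst h
    simp
  · rw [Equiv.swap_apply_of_ne_of_ne (Fin.succ_ne_zero b) (by simpa using h),
      Function.update_of_ne h, Fin.cons_succ]

/-- The linear relations on the first row of a matrix with vanishing maximal permanents. -/
lemma sum_permRelCoeff_mul_eq_zero {x : Fin (m + 1) → κ → R}
    (hx : ∀ c : Fin (m + 1) → κ, Function.Injective c → permCols x c = 0) {τ : Fin m → κ}
    (hτ : Function.Injective τ) {j k : κ} (hj : ∀ a, τ a ≠ j) (hk : ∀ a, τ a ≠ k) (hjk : j ≠ k)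
    (a : Fin m) :
    ∑ i, x 0 (τ i) * permRelCoeff (fun i ↦ x i.succ) τ j k a i = 0 := by
  set y : Fin m → κ → R := fun i ↦ x i.succ with hy
  have hj' := permCols_cons x τ j
  rw [hx _ (Fin.cons_injective_iff.2 ⟨by simpa using hj, hτ⟩)] at hj'
  have hk' := permCols_cons x τ k
  rw [hx _ (Fin.cons_injective_iff.2 ⟨by simpa using hk, hτ⟩)] at hk'
  have hinj : Function.Injective (Function.update τ a k) := by
    intro b c h
    by_cases hb : b = a <;> by_cases hc : c = a
    · rw [hb, hc]
    · subst hb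
      rw [Function.update_self, Function.update_of_ne hc] at h
      exact absurd h.symm (hk c)
    · subst hc
      rw [Function.update_self, Function.update_of_ne hb] at h
      exact absurd h (hk b)
    · rw [Function.update_of_ne hb, Function.update_of_ne hc] at h
      exact hτ h
  have hjk' := permCols_cons x (Function.update τ a k) j
  rw [hx _ (Fin.cons_injective_iff.2 ⟨?_, hinj⟩)] at hjk'
  swap
  · rintro ⟨b, hb⟩
    by_cases hba : b = a
    · subst hba
      rw [Function.update_self] at hb
      exact hjk hb.symm
    · rw [Function.update_of_ne hba] at hb
      exact hj b hb
  have hsum : ∑ b, x 0 (Function.update τ a k b) *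
      permCols y (Function.update (Function.update τ a k) b j) =
      x 0 k * permCols y (Function.update τ a j) +
      ∑ b, if b = a then 0 else
        x 0 (τ b) * permCols y (Function.update (Function.update τ a k) b j) := by
    rw [← Finset.add_sum_erase _ _ (Finset.mem_univ a), Function.update_self,
      Function.update_idem, ← Finset.add_sum_erase (a := a) (s := Finset.univ)
        (f := fun b ↦ if b = a then 0 else _) (Finset.mem_univ a), if_pos rfl, zero_add]
    congr 1
    refine Finset.sum_congr rfl fun b hb ↦ ?_
    have hba := Finset.ne_of_mem_erase hb
    rw [if_neg hba, Function.update_of_ne hba]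
  rw [← hy] at hj' hk' hjk'
  rw [hsum] at hjk'
  have hexp : ∑ i, x 0 (τ i) * permRelCoeff y τ j k a i =
      permCols y τ * (∑ b, if b = a then 0 else
        x 0 (τ b) * permCols y (Function.update (Function.update τ a k) b j)) -
      permCols y (Function.update τ a k) *
        (∑ i, x 0 (τ i) * permCols y (Function.update τ i j)) -
      permCols y (Function.update τ a j) *
        (∑ i, x 0 (τ i) * permCols y (Function.update τ i k)) := by
    rw [Finset.mul_sum, Finset.mul_sum, Finset.mul_sum, ← Finset.sum_sub_distrib,
      ← Finset.sum_sub_distrib]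
    refine Finset.sum_congr rfl fun i _ ↦ ?_
    rw [permRelCoeff]
    split_ifs <;> ring
  rw [hexp]
  linear_combination permCols y (Function.update τ a k) * hj' +
    permCols y (Function.update τ a j) * hk' - permCols y τ * hjk'

end Perm

section Membership

variable {F K : Type*} [Field F] [Field K] [Algebra F K] {m : ℕ} {κ : Type*}
  {L : IntermediateField F K}

lemma perm_mem {V : Matrix (Fin m) (Fin m) K} (h : ∀ a i, V a i ∈ L) : perm V ∈ L :=
  sum_mem fun _ _ ↦ prod_mem fun _ _ ↦ h _ _

lemma permCols_mem {y : Fin m → κ → K} {τ : Fin m → κ} (h : ∀ i a, y i (τ a) ∈ L) :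
    permCols y τ ∈ L :=
  perm_mem fun _ _ ↦ h _ _

lemma permCofactor_mem {y : Fin m → κ → K} {τ : Fin m → κ} {a : Fin m}
    (h : ∀ i b, y i (τ b) ∈ L) (i : Fin m) : permCofactor y τ a i ∈ L := by
  refine perm_mem fun b t ↦ ?_
  by_cases hb : b = a
  · subst hb
    rw [Matrix.updateRow_self, Pi.single_apply]
    split_ifs
    exacts [one_mem L, zero_mem L]
  · rw [Matrix.updateRow_ne hb]
    exact h t b

lemma permRelCoeff_mem {y : Fin m → κ → K} (h : ∀ i k, y i k ∈ L) (τ : Fin m → κ) (j k : κ)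
    (a i : Fin m) : permRelCoeff y τ j k a i ∈ L := by
  have h' (σ : Fin m → κ) : permCols y σ ∈ L := permCols_mem fun i a ↦ h i (σ a)
  rw [permRelCoeff]
  refine sub_mem (sub_mem ?_ (mul_mem (h' _) (h' _))) (mul_mem (h' _) (h' _))
  split_ifs
  exacts [zero_mem L, mul_mem (h' _) (h' _)]

variable {ι : Type*} [Fintype ι]

lemma mem_of_sum_mul_eq_zero {v c : ι → K} (h : ∑ i, v i * c i = 0) {a : ι} (ha : c a ∈ L)
    (ha0 : c a ≠ 0) (hv : ∀ i ≠ a, v i * c i ∈ L) : v a ∈ L := by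
  classical
  rw [← Finset.add_sum_erase _ _ (Finset.mem_univ a)] at h
  have h' : v a = -(∑ i ∈ Finset.univ.erase a, v i * c i) / c a := by
    rw [eq_div_iff ha0]
    exact eq_neg_of_add_eq_zero_left h
  rw [h']
  exact div_mem (neg_mem (sum_mem fun i hi ↦ hv i (Finset.ne_of_mem_erase hi))) ha

lemma mem_of_two_sum_mul_eq_zero {v c d : ι → K} (hc : ∑ i, v i * c i = 0)
    (hd : ∑ i, v i * d i = 0) (hcL : ∀ i, c i ∈ L) (hdL : ∀ i, d i ∈ L) {a b : ι}
    (hab : c a * d b - c b * d a ≠ 0) (hv : ∀ i, i ≠ a → i ≠ b → v i ∈ L) : v a ∈ L := by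
  refine mem_of_sum_mul_eq_zero (c := fun i ↦ c i * d b - c b * d i) ?_
    (sub_mem (mul_mem (hcL _) (hdL _)) (mul_mem (hcL _) (hdL _))) hab fun i hi ↦ ?_
  · have : ∑ i, v i * (c i * d b - c b * d i) =
        (∑ i, v i * c i) * d b - c b * ∑ i, v i * d i := by
      rw [Finset.sum_mul, Finset.mul_sum, ← Finset.sum_sub_distrib]
      exact Finset.sum_congr rfl fun i _ ↦ by ring
    rw [this, hc, hd, zero_mul, mul_zero, sub_zero]
  · by_cases hib : i = b
    · subst hib
      simp
    · exact mul_mem (hv i hi hib) (sub_mem (mul_mem (hcL _) (hdL _)) (mul_mem (hcL _) (hdL _)))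

end Membership

section Defect

variable {F K : Type*} [Field F] [Field K] [Algebra F K] {m : ℕ} {κ : Type*}

/-- The generic matrix, whose entries are independent variables. -/
def genericRows (F : Type*) [Field F] (m : ℕ) (κ : Type*) :
    Fin m → κ → MvPolynomial (Fin m × κ) F :=
  fun i k ↦ X (i, k)

lemma aeval_eq_zero_of_algebraicIndependent {ι : Type*} {x : ι → K}
    (hx : AlgebraicIndependent F x) {p : MvPolynomial ι F} (hp : aeval x p = 0) (z : ι → F) :
    aeval z p = 0 := by
  rw [hx (hp.trans (map_zero _).symm), map_zero]

lemma permCols_one_one (R : Type*) [CommRing R] (τ : Fin m → κ) :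
    permCols (fun _ _ ↦ (1 : R)) τ = (m.factorial : R) := by
  simp [permCols, perm, Fintype.card_perm]

variable {y : Fin m → κ → K} {τ : Fin m → κ}

lemma exists_permCofactor_ne_zero (h : permCols y τ ≠ 0) (a : Fin m) :
    ∃ i, permCofactor y τ a i ≠ 0 := by
  rw [permCols_eq_sum y τ a] at h
  obtain ⟨i, -, hi⟩ := Finset.exists_ne_zero_of_sum_ne_zero h
  exact ⟨i, right_ne_zero_of_mul hi⟩

/-- A vanishing `2 × 2` minor of the cofactors is a nontrivial algebraic relation. -/
lemma AlgDefect.of_permCofactor_minor {a b : Fin m} (hab : a ≠ b)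
    (h : permCofactor y τ a a * permCofactor y τ b b -
      permCofactor y τ a b * permCofactor y τ b a = 0) :
    AlgDefect F (fun p : Fin m × Fin m ↦ y p.1 (τ p.2)) 1 := by
  refine AlgDefect.of_not_algebraicIndependent fun hy ↦ ?_
  let C := permCofactor (genericRows F m (Fin m)) id
  have h1 := aeval_eq_zero_of_algebraicIndependent hy (p := C a a * C b b - C a b * C b a)
    (by
      have h' (a b : Fin m) : aeval (fun p : Fin m × Fin m ↦ y p.1 (τ p.2)) (C a b) =
          permCofactor y τ a b := by
        refine (map_permCofactor (aeval (R := F) _).toRingHom _ _ _ _).trans ?_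
        simp [genericRows, permCofactor]
      simp only [map_sub, map_mul, h', h]) (fun p ↦ (1 : Matrix (Fin m) (Fin m) F) p.2 p.1)
  have h' (a b : Fin m) :
      aeval (fun p : Fin m × Fin m ↦ (1 : Matrix (Fin m) (Fin m) F) p.2 p.1) (C a b) =
      perm ((1 : Matrix (Fin m) (Fin m) F).updateRow a (Pi.single b 1)) := by
    refine (map_permCofactor (aeval (R := F) _).toRingHom _ _ _ _).trans ?_
    simp only [genericRows, permCofactor, AlgHom.toRingHom_eq_coe, RingHom.coe_coe, aeval_X]
    rfl
  have hone (a : Fin m) :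
      (1 : Matrix (Fin m) (Fin m) F).updateRow a (Pi.single a 1) = 1 := by
    ext b c
    by_cases hb : b = a
    · subst hb
      simp [Matrix.one_apply, Pi.single_apply, eq_comm]
    · rw [Matrix.updateRow_ne hb]
  simp only [map_sub, map_mul, h', hone, perm_one, perm_updateRow_one_of_ne hab.symm] at h1
  simp at h1

variable [Fintype κ]

/-- A vanishing `2 × 2` minor of the relation coefficients is a nontrivial algebraic relation. -/
lemma AlgDefect.of_permRelCoeff_minor [CharZero F] {j k : κ} {a b : Fin m} (hab : a ≠ b)
    (h : permRelCoeff y τ j k a a * permRelCoeff y τ j k b b -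
      permRelCoeff y τ j k a b * permRelCoeff y τ j k b a = 0) :
    AlgDefect F (fun p : Fin m × κ ↦ y p.1 p.2) 1 := by
  refine AlgDefect.of_not_algebraicIndependent fun hy ↦ ?_
  let C := permRelCoeff (genericRows F m κ) τ j k
  have h1 := aeval_eq_zero_of_algebraicIndependent hy (p := C a a * C b b - C a b * C b a)
    (by
      have h' (a b : Fin m) : aeval (fun p : Fin m × κ ↦ y p.1 p.2) (C a b) =
          permRelCoeff y τ j k a b := by
        refine (map_permRelCoeff (aeval (R := F) _).toRingHom _ _ _ _ _ _).trans ?_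
        simp [genericRows]
      simp only [map_sub, map_mul, h', h]) (fun _ ↦ 1)
  have h' (a b : Fin m) : aeval (fun _ : Fin m × κ ↦ (1 : F)) (C a b) =
      permRelCoeff (fun _ _ ↦ (1 : F)) τ j k a b := by
    refine (map_permRelCoeff (aeval (R := F) _).toRingHom _ _ _ _ _ _).trans ?_
    simp [genericRows]
  simp only [map_sub, map_mul, h', permRelCoeff, permCols_one_one, if_neg hab, if_neg hab.symm,
    if_pos] at h1
  have h2 : 3 * (m.factorial : F) ^ 4 = 0 := by linear_combination h1
  simp [Nat.factorial_ne_zero] at h2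

lemma AlgDefect.of_permCols_update_eq_zero (h : permCols y τ ≠ 0) {j : κ} (hj : ∀ a, τ a ≠ j)
    {a : Fin m} (ha : permCols y (Function.update τ a j) = 0) :
    AlgDefect F (fun p : Fin m × κ ↦ y p.1 p.2) 1 := by
  obtain ⟨i, hi⟩ := exists_permCofactor_ne_zero h a
  rw [permCols_update] at ha
  refine AlgDefect.of_finset (E := {(i, j)}) fun L hL p hp ↦ ?_
  obtain rfl := Finset.mem_singleton.1 hp
  have hu (t : Fin m) : permCofactor y τ a t ∈ L :=
    permCofactor_mem (fun i b ↦ hL (i, τ b) (by simp [hj])) t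
  exact mem_of_sum_mul_eq_zero ha (hu i) hi fun t ht ↦
    mul_mem (hL (t, j) (by simpa using ht)) (hu t)

lemma AlgDefect.of_permCols_update_eq_zero_of_ne (h : permCols y τ ≠ 0) {j k : κ} (hjk : j ≠ k)
    (hj : ∀ a, τ a ≠ j) (hk : ∀ a, τ a ≠ k) {a b : Fin m}
    (ha : permCols y (Function.update τ a j) = 0) (hb : permCols y (Function.update τ b k) = 0) :
    AlgDefect F (fun p : Fin m × κ ↦ y p.1 p.2) 2 := by
  classical
  obtain ⟨i, hi⟩ := exists_permCofactor_ne_zero h a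
  obtain ⟨i', hi'⟩ := exists_permCofactor_ne_zero h b
  rw [permCols_update] at ha hb
  have hne : (i, j) ≠ (i', k) := fun h ↦ hjk (congrArg Prod.snd h)
  rw [← Finset.card_pair hne]
  refine AlgDefect.of_finset fun L hL p hp ↦ ?_
  have hu (a t : Fin m) : permCofactor y τ a t ∈ L :=
    permCofactor_mem (fun i b ↦ hL (i, τ b) (by simp [hj, hk])) t
  rcases Finset.mem_insert.1 hp with rfl | hp
  · exact mem_of_sum_mul_eq_zero ha (hu a i) hi fun t ht ↦
      mul_mem (hL (t, j) (by simp [ht, hjk])) (hu a t)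
  · obtain rfl := Finset.mem_singleton.1 hp
    exact mem_of_sum_mul_eq_zero hb (hu b i') hi' fun t ht ↦
      mul_mem (hL (t, k) (by simp [ht, hjk.symm])) (hu b t)

lemma AlgDefect.of_permCols_update_eq_zero_of_eq (hτ : Function.Injective τ)
    (h : permCols y τ ≠ 0) {j : κ} (hj : ∀ a, τ a ≠ j) {a b : Fin m} (hab : a ≠ b)
    (ha : permCols y (Function.update τ a j) = 0) (hb : permCols y (Function.update τ b j) = 0) :
    AlgDefect F (fun p : Fin m × κ ↦ y p.1 p.2) 2 := by
  classical
  by_cases hdet : permCofactor y τ a a * permCofactor y τ b b -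
      permCofactor y τ a b * permCofactor y τ b a = 0
  · obtain ⟨i, hi⟩ := exists_permCofactor_ne_zero h a
    rw [permCols_update] at ha
    let f : Fin m × Fin m → Fin m × κ := fun p ↦ (p.1, τ p.2)
    have hf : Function.Injective f := by
      rintro ⟨i, c⟩ ⟨i', c'⟩ hp
      exact Prod.ext (congrArg Prod.fst hp :) (hτ (congrArg Prod.snd hp :))
    have hc : AlgDefect F ((fun p : Fin m × κ ↦ y p.1 p.2) ∘ f) 1 :=
      AlgDefect.of_permCofactor_minor hab hdet
    have := hc.extend hf (E := {(i, j)}) (by simp [f, hj]) fun L hL p hp ↦ ?_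
    · rwa [Finset.card_singleton] at this
    · obtain rfl := Finset.mem_singleton.1 hp
      have hu (t : Fin m) : permCofactor y τ a t ∈ L :=
        permCofactor_mem (fun i b ↦ hL (i, τ b) (by simp [hj])) t
      exact mem_of_sum_mul_eq_zero ha (hu i) hi fun t ht ↦
        mul_mem (hL (t, j) (by simpa using ht)) (hu t)
  · rw [permCols_update] at ha hb
    have hne : (a, j) ≠ (b, j) := fun h ↦ hab (congrArg Prod.fst h)
    rw [← Finset.card_pair hne]
    refine AlgDefect.of_finset fun L hL p hp ↦ ?_
    have hu (a t : Fin m) : permCofactor y τ a t ∈ L :=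
      permCofactor_mem (fun i b ↦ hL (i, τ b) (by simp [hj])) t
    have hv (t : Fin m) (hta : t ≠ a) (htb : t ≠ b) : y t j ∈ L :=
      hL (t, j) (by simp [hta, htb])
    rcases Finset.mem_insert.1 hp with rfl | hp
    · exact mem_of_two_sum_mul_eq_zero (v := fun t ↦ y t j) ha hb (hu a) (hu b) hdet hv
    · obtain rfl := Finset.mem_singleton.1 hp
      exact mem_of_two_sum_mul_eq_zero (v := fun t ↦ y t j) hb ha (hu b) (hu a)
        (fun h ↦ hdet (by linear_combination h)) fun t htb hta ↦ hv t hta htb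

end Defect

section Main

variable {F K : Type*} [Field F] [Field K] [Algebra F K] {m : ℕ} {κ : Type*} [Fintype κ]

/-- Adding a first row to the rows of a matrix with a nonvanishing permanent on the columns `τ`
increases the defect by the number of columns not in `τ`, and by the number of entries of that
row in the columns `τ` that are determined by the rest. -/
lemma AlgDefect.of_tail {x : Fin (m + 1) → κ → K} {τ : Fin m → κ} (hτ : Function.Injective τ)
    (hx : ∀ c : Fin (m + 1) → κ, Function.Injective c → permCols x c = 0)
    (hP : permCols (fun i ↦ x i.succ) τ ≠ 0) {c : ℕ}
    (hc : AlgDefect F (fun p : Fin m × κ ↦ x p.1.succ p.2) c) (A : Finset (Fin m))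
    (hA : ∀ L : IntermediateField F K, (∀ i k, x (Fin.succ i) k ∈ L) →
      (∀ i ∉ A, x 0 (τ i) ∈ L) → ∀ i ∈ A, x 0 (τ i) ∈ L) :
    AlgDefect F (fun p : Fin (m + 1) × κ ↦ x p.1 p.2) (c + (Fintype.card κ - m + A.card)) := by
  classical
  let f : Fin m × κ → Fin (m + 1) × κ := fun p ↦ (p.1.succ, p.2)
  have hf : Function.Injective f := by
    rintro ⟨i, k⟩ ⟨i', k'⟩ hp
    exact Prod.ext (Fin.succ_injective _ (congrArg Prod.fst hp :)) (congrArg Prod.snd hp :)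
  let E : Finset (Fin (m + 1) × κ) := {0} ×ˢ (Aᶜ.image τ)ᶜ
  have hE : E.card = Fintype.card κ - m + A.card := by
    have h1 := Fintype.card_le_of_injective τ hτ
    have h2 := A.card_le_univ
    rw [Fintype.card_fin] at h1 h2
    rw [Finset.card_product, Finset.card_compl, Finset.card_image_of_injective _ hτ,
      Finset.card_compl, Finset.card_singleton, Fintype.card_fin]
    lia
  have hE0 : ∀ p ∈ E, p.1 = 0 := fun p hp ↦ by simpa using (Finset.mem_product.1 hp).1
  rw [← hE]
  have hc' : AlgDefect F ((fun p : Fin (m + 1) × κ ↦ x p.1 p.2) ∘ f) c := hc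
  refine hc'.extend hf (fun p hp ↦ Fin.succ_ne_zero p.1 (hE0 _ hp)) fun L hL ↦ ?_
  have hy (i : Fin m) (k : κ) : x i.succ k ∈ L :=
    hL (i.succ, k) fun hp ↦ Fin.succ_ne_zero i (hE0 _ hp)
  have hτL (i : Fin m) : x 0 (τ i) ∈ L := by
    have h (i : Fin m) (hi : i ∉ A) : x 0 (τ i) ∈ L := by
      refine hL (0, τ i) ?_
      simpa [E] using ⟨i, hi, rfl⟩
    by_cases hi : i ∈ A
    exacts [hA L hy h i hi, h i hi]
  rintro ⟨t, k⟩ hp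
  obtain rfl : t = 0 := hE0 _ hp
  by_cases hk : k ∈ Set.range τ
  · obtain ⟨i, rfl⟩ := hk
    exact hτL i
  · have h := permCols_cons x τ k
    rw [hx _ (Fin.cons_injective_iff.2 ⟨hk, hτ⟩)] at h
    have hmem (σ : Fin m → κ) : permCols (fun i ↦ x i.succ) σ ∈ L :=
      permCols_mem fun i a ↦ hy i (σ a)
    have h' : x 0 k = -(∑ a, x 0 (τ a) * permCols (fun i ↦ x i.succ) (Function.update τ a k)) /
        permCols (fun i ↦ x i.succ) τ := by
      rw [eq_div_iff hP]
      exact eq_neg_of_add_eq_zero_left h.symm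
    change x 0 k ∈ L
    rw [h']
    exact div_mem (neg_mem (sum_mem fun a _ ↦ mul_mem (hτL a) (hmem _))) (hmem _)

variable [CharZero F]

/-- The key estimate: the remaining rows and the entries of the first row in the columns `τ`
together contribute two to the defect. -/
lemma exists_algDefect_tail {x : Fin (m + 1) → κ → K} {τ : Fin m → κ}
    (hτ : Function.Injective τ)
    (hx : ∀ c : Fin (m + 1) → κ, Function.Injective c → permCols x c = 0)
    (hP : permCols (fun i ↦ x i.succ) τ ≠ 0) {j k : κ} (hj : ∀ a, τ a ≠ j) (hk : ∀ a, τ a ≠ k)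
    (hjk : j ≠ k) :
    ∃ (c : ℕ) (A : Finset (Fin m)), AlgDefect F (fun p : Fin m × κ ↦ x p.1.succ p.2) c ∧
      (∀ L : IntermediateField F K, (∀ i k, x (Fin.succ i) k ∈ L) →
        (∀ i ∉ A, x 0 (τ i) ∈ L) → ∀ i ∈ A, x 0 (τ i) ∈ L) ∧ min m 2 ≤ c + A.card := by
  have : CharZero K := charZero_of_injective_algebraMap (algebraMap F K).injective
  set y : Fin m → κ → K := fun i ↦ x i.succ with hy
  let C := permRelCoeff y τ j k
  have hC (a : Fin m) : ∑ i, x 0 (τ i) * C a i = 0 :=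
    sum_permRelCoeff_mul_eq_zero hx hτ hj hk hjk a
  have hCL (L : IntermediateField F K) (hL : ∀ i k, x (Fin.succ i) k ∈ L) (a i : Fin m) :
      C a i ∈ L := permRelCoeff_mem hL τ j k a i
  have hsingle {a i : Fin m} (h : C a i ≠ 0) (L : IntermediateField F K)
      (hL : ∀ i k, x (Fin.succ i) k ∈ L) (hr : ∀ t ∉ ({i} : Finset (Fin m)), x 0 (τ t) ∈ L) :
      ∀ t ∈ ({i} : Finset (Fin m)), x 0 (τ t) ∈ L := by
    intro t ht
    obtain rfl := Finset.mem_singleton.1 ht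
    exact mem_of_sum_mul_eq_zero (v := fun t ↦ x 0 (τ t)) (hC a) (hCL L hL a t) h fun s hs ↦
      mul_mem (hr s (by simpa using hs)) (hCL L hL a s)
  have hzero {a : Fin m} (h : C a a = 0) : permCols y (Function.update τ a j) = 0 ∨
      permCols y (Function.update τ a k) = 0 := by
    have h' :
        2 * (permCols y (Function.update τ a j) * permCols y (Function.update τ a k)) = 0 := by
      simp only [C, permRelCoeff, if_pos] at h
      linear_combination -h
    simpa using h'
  have htriv : AlgDefect F (fun p : Fin m × κ ↦ x p.1.succ p.2) 0 :=
    AlgDefect.of_finset (E := ∅) (by simp)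
  obtain _ | _ | n := m
  · exact ⟨0, ∅, htriv, by simp, by simp⟩
  · by_cases h : C 0 0 = 0
    · refine ⟨1, ∅, ?_, by simp, by simp⟩
      rcases hzero h with h | h
      · exact AlgDefect.of_permCols_update_eq_zero (y := y) hP hj h
      · exact AlgDefect.of_permCols_update_eq_zero (y := y) hP hk h
    · exact ⟨0, {0}, htriv, hsingle h, by simp⟩
  have hab : (0 : Fin (n + 2)) ≠ 1 := by simp
  generalize (0 : Fin (n + 2)) = a at hab
  generalize (1 : Fin (n + 2)) = b at hab
  by_cases hdet : C a a * C b b - C a b * C b a = 0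
  · have hc := AlgDefect.of_permRelCoeff_minor (F := F) (y := y) hab hdet
    by_cases h : ∃ s i, C s i ≠ 0
    · obtain ⟨s, i, h⟩ := h
      exact ⟨1, {i}, hc, hsingle h, by simp⟩
    · push Not at h
      refine ⟨2, ∅, ?_, by simp, by simp⟩
      rcases hzero (h a a) with ha | ha <;> rcases hzero (h b b) with hb | hb
      · exact AlgDefect.of_permCols_update_eq_zero_of_eq (y := y) hτ hP hj hab ha hb
      · exact AlgDefect.of_permCols_update_eq_zero_of_ne (y := y) hP hjk hj hk ha hb
      · exact AlgDefect.of_permCols_update_eq_zero_of_ne (y := y) hP hjk.symm hk hj ha hb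
      · exact AlgDefect.of_permCols_update_eq_zero_of_eq (y := y) hτ hP hk hab ha hb
  · refine ⟨0, {a, b}, htriv, fun L hL hr t ht ↦ ?_, by simp [hab]⟩
    have hr' (t) (hta : t ≠ a) (htb : t ≠ b) : x 0 (τ t) ∈ L := hr t (by simp [hta, htb])
    rcases Finset.mem_insert.1 ht with rfl | ht
    · refine mem_of_two_sum_mul_eq_zero (v := fun t ↦ x 0 (τ t)) (hC _) (hC b) (hCL L hL _)
        (hCL L hL b) hdet hr'
    · obtain rfl := Finset.mem_singleton.1 ht
      exact mem_of_two_sum_mul_eq_zero (v := fun t ↦ x 0 (τ t)) (hC _) (hC a) (hCL L hL _)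
        (hCL L hL a) (fun h ↦ hdet (by linear_combination h)) fun t htb hta ↦ hr' t hta htb

/-- A matrix with vanishing maximal permanents has large defect. -/
theorem algDefect_of_permCols_eq_zero (x : Fin m → κ → K)
    (hx : ∀ c : Fin m → κ, Function.Injective c → permCols x c = 0)
    (hm : m + 1 ≤ Fintype.card κ) {c : ℕ} (hc : c + m ≤ Fintype.card κ + min m 3) :
    AlgDefect F (fun p : Fin m × κ ↦ x p.1 p.2) c := by
  induction m generalizing c with
  | zero =>
    have := hx Fin.elim0 (Function.injective_of_subsingleton _)
    simp [permCols, perm] at this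
  | succ m ih =>
    by_cases hy : ∀ τ : Fin m → κ, Function.Injective τ → permCols (fun i ↦ x i.succ) τ = 0
    · let f : Fin m × κ → Fin (m + 1) × κ := fun p ↦ (p.1.succ, p.2)
      have hf : Function.Injective f := by
        rintro ⟨i, k⟩ ⟨i', k'⟩ hp
        exact Prod.ext (Fin.succ_injective _ (congrArg Prod.fst hp :)) (congrArg Prod.snd hp :)
      exact AlgDefect.comp hf (ih (fun i ↦ x i.succ) hy (by lia) (by lia))
    · push Not at hy
      obtain ⟨τ, hτ, hP⟩ := hy
      classical
      obtain ⟨j, hj, k, hk, hjk⟩ := Finset.one_lt_card.1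
        (show 1 < (Finset.univ.image τ)ᶜ.card by
          rw [Finset.card_compl, Finset.card_image_of_injective _ hτ, Finset.card_univ,
            Fintype.card_fin]
          lia)
      obtain ⟨d, A, hd, hA, hdA⟩ := exists_algDefect_tail (F := F) hτ hx hP (j := j) (k := k)
        (by simpa using hj) (by simpa using hk) hjk
      exact (hd.of_tail hτ hx hP A hA).mono (by lia)

end Main

/-- Permanents of submatrices given by any injective choice of columns lie in the ideal. -/
lemma permCols_mem_permanentalIdeal {l h : ℕ} {c : Fin l → Fin (l + h)}
    (hc : Function.Injective c) :
    permCols (fun i k ↦ (X (i, k) : MvPolynomial (Fin l × Fin (l + h)) ℂ)) c ∈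
      permanentalIdeal l h := by
  have hmono : StrictMono (c ∘ Tuple.sort c) :=
    (Tuple.monotone_sort c).strictMono_of_injective (hc.comp (Tuple.sort c).injective)
  refine Ideal.subset_span ⟨c ∘ Tuple.sort c, hmono, ?_⟩
  rw [permCols, ← perm_submatrix_equiv _ (Tuple.sort c), perm_eq_sum_prod_apply]
  rfl

/-- For `ℓ ≥ 3` and `h ≥ 1`, the maximal permanental ideal `I_{ℓ,ℓ+h}` over `ℂ` has
height at least `h + 3`: the codimension of `P_{ℓ,ℓ+h}` in `ℂ^{ℓ×(ℓ+h)}` is at least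
`h + 3`. -/
theorem statement17 (l h : ℕ) (hl : 3 ≤ l) (hh : 1 ≤ h) :
    ((h + 3 : ℕ) : ℕ∞) ≤ idealHeight (permanentalIdeal l h) := by
  refine le_iInf₂ fun p hp ↦ ?_
  let φ : MvPolynomial (Fin l × Fin (l + h)) ℂ →ₐ[ℂ] p.asIdeal.ResidueField :=
    IsScalarTower.toAlgHom ℂ _ _
  have hφ (f) : φ f = 0 ↔ f ∈ p.asIdeal := Ideal.algebraMap_residueField_eq_zero
  refine AlgDefect.le_height p φ hφ ?_
  refine algDefect_of_permCols_eq_zero (fun i k ↦ φ (X (i, k))) (fun c hc ↦ ?_) ?_ ?_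
  · rw [← (hφ _).2 (hp (permCols_mem_permanentalIdeal hc))]
    exact (map_permCols φ.toRingHom _ _).symm
  · simpa using hh
  · rw [Fintype.card_fin]
    lia

end
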